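/- Let p be a prime number, let K be a field equipped with a nonarchimedean (ultrametric) multiplicative norm together with a ℚ_p-algebra structure such that the norm of K extends the p-adic norm. Let λ ≥ 1 be an integer, let a_1, …, a_λ ∈ ℤ_p be p-adic integers, and let t ∈ K satisfy p^{−1/λ} < ‖t‖ < 1. Then ‖t^λ + p·a_1·t^{λ−1} + p·a_2·t^{λ−2} + ⋯ + p·a_λ‖ = ‖t‖^λ, where the elements p·a_i of ℤ_p are mapped into K via the algebra map. -/

import Mathlib

/-- Let `p` be a prime, `K` a field with a nonarchimedean multiplicative norm which is a
`ℚ_[p]`-algebra whose norm extends the `p`-adic norm.  Let `l ≥ 1`, `a 1, …, a l ∈ ℤ_[p]`,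
and `t ∈ K` with `p ^ (-1/l) < ‖t‖ < 1`.  Then
`‖t^l + p·a 1·t^(l-1) + ⋯ + p·a l‖ = ‖t‖ ^ l`. -/
theorem norm_distinguishedPoly_eval (p : ℕ) [Fact p.Prime] (K : Type*) [NormedField K]
    [IsUltrametricDist K] [Algebra ℚ_[p] K]
    (hext : ∀ x : ℚ_[p], ‖algebraMap ℚ_[p] K x‖ = ‖x‖)
    (l : ℕ) (hl : 1 ≤ l) (a : ℕ → ℤ_[p]) (t : K)
    (ht1 : (p : ℝ) ^ (-(1 : ℝ) / (l : ℝ)) < ‖t‖) (ht2 : ‖t‖ < 1) :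
    ‖t ^ l + ∑ i ∈ Finset.range l,
        algebraMap ℚ_[p] K ((p : ℚ_[p]) * (a (i + 1) : ℚ_[p])) * t ^ (l - (i + 1))‖
      = ‖t‖ ^ l := by
  have hp : (0 : ℝ) < p := by exact_mod_cast (Fact.out : p.Prime).pos
  have hinv : (p : ℝ)⁻¹ < ‖t ^ l‖ := by
    have hl0 : (l : ℝ) ≠ 0 := by positivity
    calc (p : ℝ)⁻¹ = ((p : ℝ) ^ (-(1 : ℝ) / (l : ℝ))) ^ l := by
          rw [← Real.rpow_natCast, ← Real.rpow_mul hp.le, div_mul_cancel₀ _ hl0,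
            Real.rpow_neg_one]
      _ < ‖t‖ ^ l := pow_lt_pow_left₀ ht1 (by positivity) (by omega)
      _ = ‖t ^ l‖ := (norm_pow t l).symm
  have hsum : ‖∑ i ∈ Finset.range l,
      algebraMap ℚ_[p] K ((p : ℚ_[p]) * (a (i + 1) : ℚ_[p])) * t ^ (l - (i + 1))‖
        ≤ (p : ℝ)⁻¹ := by
    refine IsUltrametricDist.norm_sum_le_of_forall_le_of_nonneg (by positivity) fun i _ => ?_
    rw [norm_mul, hext, norm_mul, Padic.norm_p, norm_pow, mul_assoc]
    exact mul_le_of_le_one_right (by positivity)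
      (mul_le_one₀ (PadicInt.norm_le_one _) (by positivity)
        (pow_le_one₀ (norm_nonneg t) ht2.le))
  rw [IsUltrametricDist.norm_add_eq_max_of_norm_ne_norm (hsum.trans_lt hinv).ne',
    max_eq_left (hsum.trans_lt hinv).le, norm_pow]
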